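/- arXiv:0912.2212 — 3 statements merged into one kernel-verified Lean document; each statement's English description precedes it below -/
import Mathlib

section
/- For u, w in a finite Coxeter group W, the intersection [1,u]_B ∩ [1,w]_L of the Bruhat lower interval of u with the left weak order lower interval of w has a unique maximal element with respect to Bruhat order; moreover this set is a lower ideal for left weak order. -/
open scoped Classical

noncomputable section

variable {B W : Type*} [Group W] {M : CoxeterMatrix B}

/-- The elementary bubble antisorting operator `π_i` on a Coxeter group:
`w·π_i = w` if `i` is a right descent of `w`, and `w·π_i = w s_i` otherwise. -/
noncomputable def piOp (cs : CoxeterSystem M W) (i : B) : W → W :=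
  fun w => if cs.IsRightDescent w i then w else w * cs.simple i

/-- The elementary bubble sorting operator `π̄_i` on a Coxeter group:
`w·π̄_i = w s_i` if `i` is a right descent of `w`, and `w·π̄_i = w` otherwise. -/
noncomputable def pibOp (cs : CoxeterSystem M W) (i : B) : W → W :=
  fun w => if cs.IsRightDescent w i then w * cs.simple i else w

/-- The biHecke monoid: the submonoid of `Function.End W` generated by the antisorting
operators `π_i` and the sorting operators `π̄_i`. -/
noncomputable def biHecke (cs : CoxeterSystem M W) : Submonoid (Function.End W) :=
  Submonoid.closure ({f | ∃ i, f = piOp cs i} ∪ {f | ∃ i, f = pibOp cs i})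

/-- Left weak order: `u ≤_L v` iff `ℓ(v u⁻¹) + ℓ(u) = ℓ(v)`. -/
noncomputable def leL (cs : CoxeterSystem M W) (u v : W) : Prop :=
  cs.length (v * u⁻¹) + cs.length u = cs.length v

/-- Right weak order: `u ≤_R v` iff `ℓ(u) + ℓ(u⁻¹ v) = ℓ(v)`. -/
noncomputable def leR (cs : CoxeterSystem M W) (u v : W) : Prop :=
  cs.length u + cs.length (u⁻¹ * v) = cs.length v

/-- Bruhat order: `u ≤_B v` iff some reduced word of `v` has a subword with product `u`. -/
noncomputable def leB (cs : CoxeterSystem M W) (u v : W) : Prop :=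
  ∃ l : List B, cs.IsReduced l ∧ cs.wordProd l = v ∧
    ∃ l' : List B, l'.Sublist l ∧ cs.wordProd l' = u

/-- Right action of a word of operators: apply the operators from left to right. -/
noncomputable def actWord (ops : B → W → W) (l : List B) (w : W) : W :=
  l.foldl (fun x i => ops i x) w

/-- The function `e_w = π_{w⁻¹ w₀} π̄_{w₀ w}` (given reduced words `l1` for `w⁻¹ w₀` and
`l2` for `w₀ w`), acting on the right. -/
noncomputable def eIdem (cs : CoxeterSystem M W) (l1 l2 : List B) : W → W :=
  fun x => actWord (pibOp cs) l2 (actWord (piOp cs) l1 x)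

/-- The parabolic subgroup `W_K`. -/
noncomputable def parab (cs : CoxeterSystem M W) (K : Set B) : Subgroup W :=
  Subgroup.closure (cs.simple '' K)

/-- `K` is a right block of `w` if `w W_K = W_J w` for some `J`. -/
noncomputable def isRightBlock (cs : CoxeterSystem M W) (w : W) (K : Set B) : Prop :=
  ∃ J : Set B, (fun x => w * x) '' (parab cs K : Set W) = (fun x => x * w) '' (parab cs J : Set W)

/-- `J` is a left block of `w` if `w W_K = W_J w` for some `K`. -/
noncomputable def isLeftBlock (cs : CoxeterSystem M W) (w : W) (J : Set B) : Prop :=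
  ∃ K : Set B, (fun x => w * x) '' (parab cs K : Set W) = (fun x => x * w) '' (parab cs J : Set W)

/-- The cutting relation: `v ⊑ w` iff `v = w^K` for some right block `K` of `w`, i.e.
`w = v · u` with `u ∈ W_K` and `v` has no right descents in `K`. -/
noncomputable def cuts (cs : CoxeterSystem M W) (v w : W) : Prop :=
  ∃ K J : Set B,
    ((fun x => w * x) '' (parab cs K : Set W) = (fun x => x * w) '' (parab cs J : Set W)) ∧
    ∃ u ∈ parab cs K, w = v * u ∧ ∀ k ∈ K, ¬ cs.IsRightDescent v k

/-- Covering relation of left weak order. -/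
noncomputable def covL (cs : CoxeterSystem M W) (x y : W) : Prop :=
  leL cs x y ∧ x ≠ y ∧ ∀ z, leL cs x z → leL cs z y → z = x ∨ z = y

end

namespace BruhatAux

open CoxeterSystem

variable {B W : Type*} [Group W] {M : CoxeterMatrix B} (cs : CoxeterSystem M W)

noncomputable def ff (i : B) : Function.End (W × ZMod 2) := fun p =>
  (cs.simple i * p.1 * cs.simple i, p.2 + if p.1 = cs.simple i then 1 else 0)

lemma braid_aux {a b : W} (ha : a * a = 1) (hb : b * b = 1) (n : ℕ) :
    b * (a * b) ^ n = ((a * b)⁻¹) ^ n * b := by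
  have ha' : a⁻¹ = a := inv_eq_of_mul_eq_one_left ha
  have hb' : b⁻¹ = b := inv_eq_of_mul_eq_one_left hb
  induction n with
  | zero => simp
  | succ n ih =>
    rw [pow_succ, ← mul_assoc, ih, pow_succ, mul_inv_rev, ha', hb']
    simp only [mul_assoc]

lemma conj_iff {r x z : W} (n : ℕ) :
    (r ^ n * x * (r⁻¹) ^ n = z ↔ x = (r⁻¹) ^ n * z * r ^ n) := by
  constructor
  · rintro rfl; simp [mul_assoc]
  · rintro rfl; simp [mul_assoc]

lemma ff_pow (i j : B) (n : ℕ) (x : W) (e : ZMod 2) :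
    ((ff cs i * ff cs j) ^ n) (x, e) =
      ((cs.simple i * cs.simple j) ^ n * x * ((cs.simple i * cs.simple j)⁻¹) ^ n,
        e + ∑ k ∈ Finset.range (2 * n),
          if x = ((cs.simple i * cs.simple j)⁻¹) ^ k * cs.simple j then 1 else 0) := by
  have ha := cs.simple_mul_simple_self i
  have hb := cs.simple_mul_simple_self j
  induction n with
  | zero => simp [Function.End.one_def]
  | succ n ih =>
    have e1 : ((ff cs i * ff cs j) ^ (n + 1)) (x, e)
      = ff cs i (ff cs j (((ff cs i * ff cs j) ^ n) (x, e))) := by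
      rw [pow_succ']; rfl
    rw [e1, ih, show 2 * (n + 1) = 2 * n + 1 + 1 by ring, Finset.sum_range_succ,
      Finset.sum_range_succ]
    simp only [ff]
    have h0 := braid_aux ha hb n
    have c1 : ((cs.simple i * cs.simple j) ^ n * x *
        ((cs.simple i * cs.simple j)⁻¹) ^ n = cs.simple j) ↔
        x = ((cs.simple i * cs.simple j)⁻¹) ^ (2 * n) * cs.simple j := by
      rw [conj_iff, mul_assoc, h0, two_mul, pow_add, mul_assoc]
    have c2 : (cs.simple j * ((cs.simple i * cs.simple j) ^ n * x *
        ((cs.simple i * cs.simple j)⁻¹) ^ n) * cs.simple j = cs.simple i) ↔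
        x = ((cs.simple i * cs.simple j)⁻¹) ^ (2 * n + 1) * cs.simple j := by
      have : ∀ y : W, cs.simple j * y * cs.simple j = cs.simple i ↔
          y = (cs.simple i * cs.simple j)⁻¹ * cs.simple j := by
        intro y
        constructor
        · intro h
          rw [mul_inv_rev, inv_simple, inv_simple]
          rw [← h]
          simp [mul_assoc]
        · rintro rfl
          simp [mul_assoc]
      rw [this, conj_iff, mul_assoc, mul_assoc, h0, ← mul_assoc, ← mul_assoc, ← pow_succ,
        ← pow_add]
      rw [show n + 1 + n = 2 * n + 1 by ring]
    simp only [c1, c2]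
    refine Prod.ext ?_ ?_
    · simp only [pow_succ' (cs.simple i * cs.simple j), pow_succ (cs.simple j * cs.simple i),
        mul_inv_rev, inv_simple, mul_assoc]
    · simp only [add_assoc]

lemma ff_liftable : M.IsLiftable (ff cs) := by
  intro i j
  funext ⟨x, e⟩
  rw [ff_pow, inv_pow, cs.simple_mul_simple_pow, two_mul, Finset.sum_range_add]
  simp only [pow_add, inv_pow, cs.simple_mul_simple_pow]
  simp [Function.End.one_def, CharTwo.add_self_eq_zero]

noncomputable def phi : W →* Function.End (W × ZMod 2) := cs.lift ⟨ff cs, ff_liftable cs⟩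

lemma phi_word (l : List B) (x : W) (e : ZMod 2) :
    phi cs (cs.wordProd l) (x, e) =
      (cs.wordProd l * x * (cs.wordProd l)⁻¹, e + ((cs.rightInvSeq l).count x : ZMod 2)) := by
  induction l with
  | nil => simp [Function.End.one_def]
  | cons i l ih =>
    rw [wordProd_cons, map_mul]
    change phi cs (cs.simple i) (phi cs (cs.wordProd l) (x, e)) = _
    rw [ih, phi, cs.lift_apply_simple]
    have h : cs.wordProd l * x * (cs.wordProd l)⁻¹ = cs.simple i ↔
        (cs.wordProd l)⁻¹ * cs.simple i * cs.wordProd l = x := by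
      constructor
      · intro h; rw [← h]; group
      · rintro rfl; group
    simp only [ff, rightInvSeq, h]
    simp only [List.count_cons, mul_inv_rev, inv_simple, mul_assoc]
    simp [add_assoc]

lemma phi_add (g : W) (x : W) : ∃ n : ZMod 2, ∀ e, phi cs g (x, e) = (g * x * g⁻¹, e + n) := by
  obtain ⟨l, rfl⟩ := cs.wordProd_surjective g
  exact ⟨_, fun e => phi_word cs l x e⟩

lemma phi_refl {t : W} (ht : cs.IsReflection t) (e : ZMod 2) : phi cs t (t, e) = (t, e + 1) := by
  obtain ⟨g, i, rfl⟩ := ht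
  set t := g * cs.simple i * g⁻¹ with ht
  obtain ⟨n, hn⟩ := phi_add cs g⁻¹ t
  obtain ⟨m, hm⟩ := phi_add cs g (cs.simple i)
  have h1 : g⁻¹ * t * g⁻¹⁻¹ = cs.simple i := by rw [ht]; group
  have hs : ∀ e, phi cs (cs.simple i) (cs.simple i, e) = (cs.simple i, e + 1) := by
    intro e
    rw [phi, cs.lift_apply_simple]; simp [ff]
  have key : ∀ e, phi cs g (phi cs g⁻¹ (t, e)) = (t, e) := by
    intro e
    change (phi cs g * phi cs g⁻¹) (t, e) = _
    rw [← map_mul]; simp [Function.End.one_def]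
  have k0 := key e
  rw [hn, h1, hm] at k0
  have : phi cs t (t, e) = phi cs g (phi cs (cs.simple i) (phi cs g⁻¹ (t, e))) := by
    conv_lhs => rw [ht, map_mul, map_mul]
    rfl
  rw [this, hn, h1, hs, hm]
  have k1 := congrArg Prod.snd k0
  have k2 := congrArg Prod.fst k0
  exact Prod.ext k2 (by linear_combination k1)

lemma strong_exch {t : W} (ht : cs.IsReflection t) (l : List B)
    (h : cs.length (cs.wordProd l * t) < cs.length (cs.wordProd l)) :
    t ∈ cs.rightInvSeq l := by
  by_contra hn
  have hc : (cs.rightInvSeq l).count t = 0 := List.count_eq_zero.2 hn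
  obtain ⟨l', hl', he⟩ := cs.exists_isReduced (cs.wordProd l * t)
  have h1 : phi cs (cs.wordProd l * t) (t, 0) =
      phi cs (cs.wordProd l) (phi cs t (t, 0)) := by rw [map_mul]; rfl
  rw [phi_refl cs ht, phi_word, hc, he, phi_word] at h1
  have h2 := congrArg Prod.snd h1
  simp only at h2
  have h3 : t ∈ cs.rightInvSeq l' := by
    by_contra h4
    rw [List.count_eq_zero.2 h4] at h2
    simp at h2
  have h5 := (cs.isRightInversion_of_mem_rightInvSeq hl' h3).2
  rw [← he, mul_assoc, ht.mul_self, mul_one] at h5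
  omega

lemma strong_exch' {t : W} (ht : cs.IsReflection t) (l : List B)
    (h : cs.length (cs.wordProd l * t) < cs.length (cs.wordProd l)) :
    ∃ j < l.length, cs.wordProd l * t = cs.wordProd (l.eraseIdx j) := by
  have := strong_exch cs ht l h
  obtain ⟨j, hj, hjt⟩ := List.getElem_of_mem this
  refine ⟨j, by simpa using hj, ?_⟩
  rw [← cs.wordProd_mul_getD_rightInvSeq, List.getD_eq_getElem _ _ hj, hjt]

/-- One Bruhat step. -/
def R (a b : W) : Prop := cs.IsReflection (b⁻¹ * a) ∧ cs.length a < cs.length b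

def le (a b : W) : Prop := Relation.ReflTransGen (R cs) a b

variable {cs}

lemma le.trans {a b c : W} (h : le cs a b) (h' : le cs b c) : le cs a c :=
  Relation.ReflTransGen.trans h h'

lemma le.refl (a : W) : le cs a a := Relation.ReflTransGen.refl

lemma R.exch {a b : W} (h : R cs a b) (l : List B) (hl : cs.wordProd l = b) :
    ∃ j < l.length, a = cs.wordProd (l.eraseIdx j) := by
  obtain ⟨h1, h2⟩ := h
  subst hl
  obtain ⟨j, hj, e⟩ := strong_exch' cs h1 l (by simpa using h2)
  exact ⟨j, hj, by simpa using e⟩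

lemma le.sub {a b : W} (h : le cs a b) : ∀ (l : List B), cs.wordProd l = b →
    ∃ l', l'.Sublist l ∧ cs.wordProd l' = a := by
  unfold le at h
  induction h with
  | refl => intro l hl; exact ⟨l, List.Sublist.refl _, hl⟩
  | tail _ h2 ih =>
    intro l hl
    obtain ⟨j, hj, e⟩ := h2.exch l hl
    obtain ⟨l', s, e'⟩ := ih _ e.symm
    exact ⟨l', s.trans (List.eraseIdx_sublist _ _), e'⟩

lemma R.simple {a : W} {i : B} (h : cs.length a < cs.length (cs.simple i * a)) :
    R cs a (cs.simple i * a) := by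
  refine ⟨⟨a⁻¹, i, ?_⟩, h⟩
  simp

lemma R.simple' {a : W} {i : B} (h : cs.length (cs.simple i * a) < cs.length a) :
    R cs (cs.simple i * a) a := by
  refine ⟨⟨a⁻¹, i, ?_⟩, h⟩
  simp [mul_assoc]

lemma R.simple_right {a : W} {i : B} (h : cs.length a < cs.length (a * cs.simple i)) :
    R cs a (a * cs.simple i) := by
  refine ⟨⟨1, i, ?_⟩, h⟩
  simp

lemma R.lift {a b : W} (h : R cs a b) (i : B) :
    cs.simple i * a = b ∨ R cs (cs.simple i * a) (cs.simple i * b) := by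
  have href : cs.IsReflection ((cs.simple i * b)⁻¹ * (cs.simple i * a)) := by
    simpa [mul_assoc] using h.1
  rcases lt_or_ge (cs.length (cs.simple i * a)) (cs.length (cs.simple i * b)) with hlt | hge
  · exact Or.inr ⟨href, hlt⟩
  · left
    have hne : cs.length (cs.simple i * b) ≠ cs.length (cs.simple i * a) := by
      have := href.length_mul_left_ne (cs.simple i * b)
      rw [mul_inv_cancel_left] at this
      exact this.symm
    have hR : R cs (cs.simple i * b) (cs.simple i * a) := by
      refine ⟨?_, by omega⟩
      have := href.isReflection_inv
      simpa [mul_assoc] using this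
    obtain ⟨l, hl, e⟩ := cs.exists_isReduced a
    obtain ⟨j, hj, e2⟩ := hR.exch (i :: l) (by rw [wordProd_cons, e])
    cases j with
    | zero =>
      simp only [List.eraseIdx_cons_zero] at e2
      rw [e, ← e2]; simp
    | succ j =>
      exfalso
      rw [List.eraseIdx_cons_succ, wordProd_cons] at e2
      have e3 := mul_left_cancel e2
      have h4 := cs.length_wordProd_le (l.eraseIdx j)
      rw [← e3] at h4
      have h5 := List.length_eraseIdx_le l j
      have h6 := h.2
      rw [e, hl.eq] at h6
      omega

lemma le.lift {a b : W} (h : le cs a b) (i : B) :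
    le cs (cs.simple i * a) b ∨ le cs (cs.simple i * a) (cs.simple i * b) := by
  unfold le at h
  induction h using Relation.ReflTransGen.head_induction_on with
  | refl => exact Or.inr (le.refl _)
  | head h1 h2 ih =>
    rcases h1.lift i with h3 | h3
    · left; rw [h3]; exact h2
    · rcases ih with h4 | h4
      · left; exact Relation.ReflTransGen.head h3 h4
      · right; exact Relation.ReflTransGen.head h3 h4

lemma le.lift_up {a b : W} (h : le cs a b) {i : B}
    (hb : cs.length b < cs.length (cs.simple i * b)) :
    le cs (cs.simple i * a) (cs.simple i * b) := by
  rcases h.lift i with h | h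
  · exact h.trans (Relation.ReflTransGen.single (R.simple hb))
  · exact h

lemma le.lift_down {a b : W} (h : le cs a b) {i : B}
    (hb : cs.length (cs.simple i * b) < cs.length b) :
    le cs (cs.simple i * a) b := by
  rcases h.lift i with h | h
  · exact h
  · exact h.trans (Relation.ReflTransGen.single (R.simple' hb))

lemma red_tail {i : B} {l : List B} (h : cs.IsReduced (i :: l)) : cs.IsReduced l := by
  simpa using h.drop 1

lemma le_of_sub {l : List B} (hl : cs.IsReduced l) {l' : List B} (hs : l'.Sublist l) :
    le cs (cs.wordProd l') (cs.wordProd l) := by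
  induction hs with
  | slnil => exact le.refl _
  | @cons l₁ l₂ i hs ih =>
    have hr := red_tail hl
    refine (ih hr).trans (Relation.ReflTransGen.single ?_)
    have := hl.eq
    rw [wordProd_cons] at this ⊢
    refine R.simple ?_
    rw [this, hr.eq]; simp
  | @cons_cons l₁ l₂ i hs ih =>
    have hr := red_tail hl
    have := hl.eq
    rw [wordProd_cons] at this
    rw [wordProd_cons, wordProd_cons]
    refine (ih hr).lift_up ?_
    rw [this, hr.eq]; simp

lemma leB_iff {a b : W} : leB cs a b ↔ le cs a b := by
  constructor
  · rintro ⟨l, hl, rfl, l', hs, rfl⟩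
    exact le_of_sub hl hs
  · intro h
    obtain ⟨l, hl, e⟩ := cs.exists_isReduced b
    obtain ⟨l', h1, h2⟩ := h.sub l e.symm
    exact ⟨l, hl, e.symm, l', h1, h2⟩

lemma cancel_one {x v : W} {i : B} (hx : cs.length x < cs.length (x * cs.simple i))
    (h : le cs (x * cs.simple i) (v * cs.simple i)) : le cs x v := by
  obtain ⟨l, hl, rfl⟩ := cs.exists_isReduced v
  obtain ⟨l', h1, h2⟩ := h.sub (l ++ [i]) (by simp [wordProd_append])
  rw [List.sublist_append_iff] at h1
  obtain ⟨p, q, rfl, hp, hq⟩ := h1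
  have hle := le_of_sub hl hp
  rcases List.sublist_singleton.1 hq with rfl | rfl
  · simp only [List.append_nil] at h2
    rw [h2] at hle
    exact le.trans (Relation.ReflTransGen.single (R.simple_right hx)) hle
  · simp only [wordProd_append, wordProd_singleton] at h2
    rw [mul_right_cancel h2] at hle
    exact hle

lemma cancel (l : List B) : ∀ {x v : W},
    cs.length (x * cs.wordProd l) = cs.length x + l.length →
    le cs (x * cs.wordProd l) (v * cs.wordProd l) → le cs x v := by
  induction l with
  | nil => intro x v _ h; simpa using h
  | cons i l ih =>
    intro x v hx h
    rw [wordProd_cons, ← mul_assoc] at hx h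
    rw [← mul_assoc] at h
    have h1 := cs.length_mul_le (x * cs.simple i) (cs.wordProd l)
    have h2 := cs.length_wordProd_le l
    have h3 := cs.length_mul_le x (cs.simple i)
    rw [length_simple] at h3
    simp only [List.length_cons] at hx
    exact cancel_one (by omega) (ih (by omega) h)

lemma exists_max (c : W) (l : List B) : ∃ l', l'.Sublist l ∧
    cs.length (cs.wordProd l' * c) = cs.length (cs.wordProd l') + cs.length c ∧
    ∀ l'', l''.Sublist l → le cs (cs.wordProd l'' * c) (cs.wordProd l' * c) := by
  induction l with
  | nil =>
    refine ⟨[], List.Sublist.refl _, by simp, ?_⟩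
    intro l'' h
    rw [List.sublist_nil.1 h]
    exact le.refl _
  | cons i l ih =>
    obtain ⟨m, hm, ha, hmax⟩ := ih
    rcases cs.length_simple_mul (cs.wordProd m * c) i with h | h
    · refine ⟨i :: m, hm.cons_cons i, ?_, ?_⟩
      · rw [wordProd_cons, mul_assoc]
        have h1 := cs.length_mul_le (cs.simple i * cs.wordProd m) c
        have h2 := cs.length_mul_le (cs.simple i) (cs.wordProd m)
        rw [length_simple] at h2
        rw [mul_assoc] at h1
        omega
      · intro l'' hl
        rw [wordProd_cons, mul_assoc]
        rcases List.sublist_cons_iff.1 hl with h2 | ⟨r, rfl, h2⟩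
        · exact (hmax _ h2).trans (Relation.ReflTransGen.single (R.simple (by omega)))
        · rw [wordProd_cons, mul_assoc]
          exact (hmax _ h2).lift_up (by omega)
    · refine ⟨m, hm.cons i, ha, ?_⟩
      intro l'' hl
      rcases List.sublist_cons_iff.1 hl with h2 | ⟨r, rfl, h2⟩
      · exact hmax _ h2
      · rw [wordProd_cons, mul_assoc]
        exact (hmax _ h2).lift_down (by omega)

lemma exists_max' (c u : W) : ∃ v, le cs v u ∧
    cs.length (v * c) = cs.length v + cs.length c ∧
    ∀ x, le cs x u → cs.length (x * c) = cs.length x + cs.length c → le cs x v := by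
  obtain ⟨l, hl, rfl⟩ := cs.exists_isReduced u
  obtain ⟨m, hm, ha, hmax⟩ := exists_max (cs := cs) c l
  refine ⟨cs.wordProd m, le_of_sub hl hm, ha, ?_⟩
  intro x hx hxc
  obtain ⟨l', hs, rfl⟩ := hx.sub l rfl
  have := hmax l' hs
  obtain ⟨lc, hlc, rfl⟩ := cs.exists_isReduced c
  rw [hlc.eq] at hxc
  exact cancel lc hxc this

lemma longest {w0 : W} (h0 : ∀ x, cs.length x ≤ cs.length w0) (l : List B) :
    cs.IsReduced l → leL cs (cs.wordProd l) w0 := by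
  induction l with
  | nil => intro _; simp [leL]
  | cons i l ih =>
    intro hl
    have hr := red_tail hl
    have ih := ih hr
    unfold leL at ih ⊢
    have hl' := hl.eq
    have hr' := hr.eq
    rw [wordProd_cons] at *
    set z := cs.wordProd l with hz
    obtain ⟨k, hk, ek⟩ := cs.exists_isReduced (w0 * z⁻¹)
    have hw : cs.wordProd (k ++ l) = w0 := by
      rw [wordProd_append, ← ek]; simp [hz]
    have hR : R cs (w0 * z⁻¹ * cs.simple i * z) w0 := by
      have href : cs.IsReflection (w0⁻¹ * (w0 * z⁻¹ * cs.simple i * z)) :=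
        ⟨z⁻¹, i, by group⟩
      refine ⟨href, lt_of_le_of_ne (h0 _) ?_⟩
      have := href.length_mul_left_ne w0
      rwa [mul_inv_cancel_left] at this
    obtain ⟨j, hj, e⟩ := hR.exch _ hw
    have hlen : cs.length (w0 * z⁻¹) = k.length := by rw [ek]; exact hk.eq
    rw [mul_inv_rev, inv_simple, ← mul_assoc]
    rw [List.length_append] at hj
    simp only [List.length_cons] at hl'
    rcases lt_or_ge j k.length with hjk | hjk
    · rw [List.eraseIdx_append_of_lt_length hjk, wordProd_append] at e
      have e2 := mul_right_cancel e
      have h4 := cs.length_wordProd_le (k.eraseIdx j)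
      rw [← e2, List.length_eraseIdx_of_lt hjk] at h4
      have h5 := cs.length_mul_le (w0 * z⁻¹ * cs.simple i) (cs.simple i * z)
      rw [show w0 * z⁻¹ * cs.simple i * (cs.simple i * z) = w0 by simp [mul_assoc]] at h5
      omega
    · exfalso
      rw [List.eraseIdx_append_of_length_le hjk, wordProd_append, ← ek, mul_assoc] at e
      have e2 := mul_left_cancel e
      have h4 := cs.length_wordProd_le (l.eraseIdx (j - k.length))
      rw [← e2] at h4
      have h5 := List.length_eraseIdx_le l (j - k.length)
      omega

lemma longest' {w0 : W} (h0 : ∀ x, cs.length x ≤ cs.length w0) (z : W) : leL cs z w0 := by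
  obtain ⟨l, hl, rfl⟩ := cs.exists_isReduced z
  exact longest h0 l hl

lemma leL_trans {x y z : W} (h1 : leL cs x y) (h2 : leL cs y z) : leL cs x z := by
  unfold leL at *
  have h3 := cs.length_mul_le (z * y⁻¹) (y * x⁻¹)
  have h4 := cs.length_mul_le (z * x⁻¹) x
  rw [show z * y⁻¹ * (y * x⁻¹) = z * x⁻¹ by group] at h3
  rw [inv_mul_cancel_right] at h4
  omega

lemma le_of_leL {x y : W} (h : leL cs x y) : le cs x y := by
  unfold leL at h
  obtain ⟨l, hl, rfl⟩ := cs.exists_isReduced x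
  obtain ⟨k, hk, e⟩ := cs.exists_isReduced (y * (cs.wordProd l)⁻¹)
  have hy : y = cs.wordProd (k ++ l) := by
    rw [wordProd_append, ← e]; simp
  rw [e, hk.eq, hl.eq] at h
  rw [hy]
  refine le_of_sub ?_ (List.sublist_append_right k l)
  unfold CoxeterSystem.IsReduced
  rw [← hy, ← h]; simp

end BruhatAux

open BruhatAux
/-- The intersection `[1,u]_B ∩ [1,w]_L` has a unique maximal element for Bruhat order,
and is a lower ideal for left weak order. -/
theorem bruhat_left_intersection_max {B W : Type*} [Group W] [Finite W] {M : CoxeterMatrix B}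
    (cs : CoxeterSystem M W) (u w : W) :
    (∃ v, (leB cs v u ∧ leL cs v w) ∧
      ∀ x, leB cs x u → leL cs x w → leB cs x v) ∧
    (∀ x, leB cs x u → leL cs x w → ∀ y, leL cs y x → leB cs y u ∧ leL cs y w) := by

  simp only [leB_iff]
  constructor
  · obtain ⟨w0, h0⟩ := Finite.exists_max cs.length
    obtain ⟨v, h1, h2, h3⟩ := exists_max' (cs := cs) (w⁻¹ * w0) u
    have hc := longest' (cs := cs) h0 (w⁻¹ * w0)
    unfold leL at *
    rw [show w0 * (w⁻¹ * w0)⁻¹ = w by group] at hc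
    refine ⟨v, ⟨h1, ?_⟩, ?_⟩
    · have hv := longest' (cs := cs) h0 (v * (w⁻¹ * w0))
      unfold leL at hv
      rw [show w0 * (v * (w⁻¹ * w0))⁻¹ = w * v⁻¹ by group] at hv
      omega
    · intro x hx hxw
      refine h3 x hx ?_
      have h4 := cs.length_mul_le (w * x⁻¹) (x * (w⁻¹ * w0))
      rw [show w * x⁻¹ * (x * (w⁻¹ * w0)) = w0 by group] at h4
      have h5 := cs.length_mul_le x (w⁻¹ * w0)
      omega
  · intro x hx hxw y hy
    exact ⟨(le_of_leL hy).trans hx, leL_trans hy hxw⟩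
end

section
/- For w ∈ W and u ∈ W, the idempotent e_w = π_{w^{-1}w_0} π̄_{w_0 w} satisfies e_w(u) = max_{≤_B}([1,u]_B ∩ [1,w]_L), the Bruhat-maximal element of the intersection of the Bruhat interval below u with the left order interval below w. -/
open scoped Classical

section Helpers

variable {B W : Type*} [Group W] {M : CoxeterMatrix B}

/-- The signed-reflection operator. -/
noncomputable def sgnOp (cs : CoxeterSystem M W) (i : B) : Function.End (W × ZMod 2) :=
  fun p => (cs.simple i * p.1 * cs.simple i, p.2 + if p.1 = cs.simple i then 1 else 0)

theorem simple_conj_pow (cs : CoxeterSystem M W) (i j : B) (r : ℕ) :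
    (cs.simple i * cs.simple j) ^ r * (cs.simple j * (cs.simple i * cs.simple j) ^ r)
      = cs.simple j := by
  induction r with
  | zero => simp
  | succ r ih =>
    have e1 : (cs.simple i * cs.simple j) ^ (r + 1)
      = (cs.simple i * cs.simple j) ^ r * (cs.simple i * cs.simple j) := pow_succ _ _
    have e2 : (cs.simple i * cs.simple j) ^ (r + 1)
      = (cs.simple i * cs.simple j) * (cs.simple i * cs.simple j) ^ r := pow_succ' _ _
    nth_rewrite 1 [e1]
    rw [e2]
    generalize (cs.simple i * cs.simple j) ^ r = c at ih ⊢
    simpa [mul_assoc] using ih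

theorem conj_iff_A (cs : CoxeterSystem M W) (i j : B) (r : ℕ) (t : W) :
    (cs.simple i * cs.simple j) ^ r * t * ((cs.simple i * cs.simple j) ^ r)⁻¹ = cs.simple j ↔
    t = cs.simple j * (cs.simple i * cs.simple j) ^ (2 * r) := by
  have h := simple_conj_pow cs i j r
  set c := (cs.simple i * cs.simple j) ^ r with hc
  rw [mul_comm 2 r, pow_mul, ← hc, pow_two, mul_inv_eq_iff_eq_mul]
  constructor
  · intro h'
    have : t = c⁻¹ * (cs.simple j * c) := by rw [← h']; group
    rw [this]
    nth_rewrite 1 [← h]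
    group
  · rintro rfl
    calc _ = c * (cs.simple j * c) * c := by group
      _ = _ := by rw [h]

theorem conj_iff_B (cs : CoxeterSystem M W) (i j : B) (r : ℕ) (t : W) :
    cs.simple j * ((cs.simple i * cs.simple j) ^ r * t * ((cs.simple i * cs.simple j) ^ r)⁻¹)
      * cs.simple j = cs.simple i ↔
    t = cs.simple j * (cs.simple i * cs.simple j) ^ (2 * r + 1) := by
  have h := simple_conj_pow cs i j r
  have e : cs.simple i * cs.simple j * (cs.simple i * cs.simple j) ^ r =
    (cs.simple i * cs.simple j) ^ r * (cs.simple i * cs.simple j) := by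
      rw [← pow_succ, ← pow_succ']
  rw [pow_succ, mul_comm 2 r, pow_mul, pow_two]
  have hj := cs.simple_mul_simple_self j
  set c := (cs.simple i * cs.simple j) ^ r with hc
  have hji : (cs.simple j)⁻¹ = cs.simple j := cs.inv_simple j
  have h2 : cs.simple j * c * c = c⁻¹ * cs.simple j * c := by
    nth_rewrite 2 [← h]; group
  constructor
  · intro h'
    have : t = c⁻¹ * ((cs.simple j)⁻¹ * cs.simple i * (cs.simple j)⁻¹) * c := by rw [← h']; group
    rw [this, hji, ← mul_assoc (cs.simple j) (c * c), ← mul_assoc (cs.simple j) c c, h2, mul_assoc _ c, ← e]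
    group
  · intro h'
    have : t = c⁻¹ * ((cs.simple j) * cs.simple i * (cs.simple j)) * c := by
      rw [h', ← mul_assoc (cs.simple j) (c * c), ← mul_assoc (cs.simple j) c c, h2, mul_assoc _ c, ← e]
      group
    rw [this]
    calc _ = (cs.simple j * cs.simple j) * cs.simple i * (cs.simple j * cs.simple j) := by group
      _ = _ := by rw [hj]; simp

theorem sgnOp_pow (cs : CoxeterSystem M W) (i j : B) (r : ℕ) (p : W × ZMod 2) :
    ((sgnOp cs i * sgnOp cs j) ^ r) p =
      ((cs.simple i * cs.simple j) ^ r * p.1 * ((cs.simple i * cs.simple j) ^ r)⁻¹,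
        p.2 + ∑ n ∈ Finset.range (2 * r),
          if p.1 = cs.simple j * (cs.simple i * cs.simple j) ^ n then 1 else 0) := by
  induction r with
  | zero => simp; rfl
  | succ r ih =>
    rw [pow_succ']
    change sgnOp cs i (sgnOp cs j (((sgnOp cs i * sgnOp cs j) ^ r) p)) = _
    rw [ih]
    unfold sgnOp
    simp only [conj_iff_A, conj_iff_B]
    rw [show 2 * (r + 1) = 2 * r + 1 + 1 by ring, Finset.sum_range_succ, Finset.sum_range_succ]
    refine Prod.ext ?_ ?_
    · simp only [pow_succ' _ r, mul_inv_rev, cs.inv_simple, mul_assoc]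
    · simp only [add_assoc]

theorem sgnOp_liftable (cs : CoxeterSystem M W) : M.IsLiftable (sgnOp cs) := by
  intro i j
  funext p
  rw [sgnOp_pow, cs.simple_mul_simple_pow]
  rw [two_mul, Finset.sum_range_add]
  simp only [pow_add, cs.simple_mul_simple_pow, one_mul]
  rw [CharTwo.add_self_eq_zero]
  simp; rfl

/-- The lifted action. -/
noncomputable def sgnHom (cs : CoxeterSystem M W) : W →* Function.End (W × ZMod 2) :=
  cs.lift ⟨sgnOp cs, sgnOp_liftable cs⟩

theorem sgnHom_simple (cs : CoxeterSystem M W) (i : B) : sgnHom cs (cs.simple i) = sgnOp cs i :=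
  cs.lift_apply_simple (sgnOp_liftable cs) i

theorem sgnHom_wordProd (cs : CoxeterSystem M W) (l : List B) (p : W × ZMod 2) :
    sgnHom cs (cs.wordProd l) p =
      (cs.wordProd l * p.1 * (cs.wordProd l)⁻¹, p.2 + ((cs.rightInvSeq l).count p.1 : ℕ)) := by
  induction l with
  | nil => simp; rfl
  | cons i l ih =>
    rw [cs.wordProd_cons, map_mul, sgnHom_simple]
    change sgnOp cs i (sgnHom cs (cs.wordProd l) p) = _
    rw [ih]
    unfold sgnOp
    refine Prod.ext ?_ ?_
    · simp [mul_assoc]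
    · simp only [CoxeterSystem.rightInvSeq, List.count_cons]
      have : (((cs.wordProd l)⁻¹ * cs.simple i * cs.wordProd l == p.1) = true) ↔
          cs.wordProd l * p.1 * (cs.wordProd l)⁻¹ = cs.simple i := by
        rw [beq_iff_eq]
        constructor
        · intro h; rw [← h]; group
        · intro h; rw [← h]; group
      simp only [this]
      push_cast
      simp [add_assoc]

theorem sgnHom_apply (cs : CoxeterSystem M W) (w t : W) (e : ZMod 2) :
    sgnHom cs w (t, e) = (w * t * w⁻¹, (sgnHom cs w (t, 0)).2 + e) := by
  obtain ⟨l, rfl⟩ := cs.wordProd_surjective w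
  rw [sgnHom_wordProd, sgnHom_wordProd]
  simp [add_comm]

theorem sgnHom_reflection (cs : CoxeterSystem M W) {t : W} (ht : cs.IsReflection t) :
    sgnHom cs t (t, 0) = (t, 1) := by
  obtain ⟨w, i, rfl⟩ := ht
  have key : ∀ p, sgnHom cs (w * cs.simple i * w⁻¹) p
      = sgnHom cs w (sgnOp cs i (sgnHom cs w⁻¹ p)) := by
    intro p; rw [map_mul, map_mul, sgnHom_simple]; rfl
  rw [key, sgnHom_apply cs w⁻¹]
  set a := (sgnHom cs w⁻¹ (w * cs.simple i * w⁻¹, 0)).2 with ha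
  have h1 : w⁻¹ * (w * cs.simple i * w⁻¹) * w⁻¹⁻¹ = cs.simple i := by group
  rw [h1]
  have h2 : sgnHom cs w (sgnHom cs w⁻¹ (w * cs.simple i * w⁻¹, 0)) = (w * cs.simple i * w⁻¹, 0) := by
    change (sgnHom cs w * sgnHom cs w⁻¹) _ = _
    rw [← map_mul]; simp; rfl
  rw [sgnHom_apply cs w⁻¹, h1, ← ha, sgnHom_apply cs w] at h2
  have h3 := congrArg Prod.snd h2
  simp only [add_zero] at h3
  unfold sgnOp
  simp only [add_zero, if_true]
  rw [sgnHom_apply cs w]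
  refine Prod.ext ?_ ?_
  · simp
  · simp only
    rw [← add_assoc, cs.simple_mul_simple_self, one_mul, h3, zero_add]

theorem strong_exchange (cs : CoxeterSystem M W) (l : List B) {t : W} (ht : cs.IsReflection t)
    (hlt : cs.length (cs.wordProd l * t) < cs.length (cs.wordProd l)) :
    t ∈ cs.rightInvSeq l := by
  by_contra hn
  have h0 : sgnHom cs (cs.wordProd l) (t, 1) = (cs.wordProd l * t * (cs.wordProd l)⁻¹, 1) := by
    rw [sgnHom_wordProd]; simp [List.count_eq_zero_of_not_mem hn]
  obtain ⟨l', hl', he⟩ := cs.exists_isReduced (cs.wordProd l * t)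
  have h1 : sgnHom cs (cs.wordProd l * t) (t, 0) = sgnHom cs (cs.wordProd l) (sgnHom cs t (t, 0)) := by
    rw [map_mul]; rfl
  rw [sgnHom_reflection cs ht, h0, he, sgnHom_wordProd] at h1
  have h2 := congrArg Prod.snd h1
  simp only [zero_add] at h2
  have hm : t ∈ cs.rightInvSeq l' := by
    by_contra hn'
    rw [List.count_eq_zero_of_not_mem hn'] at h2
    simp at h2
  have h3 := (cs.isRightInversion_of_mem_rightInvSeq hl' hm).2
  rw [← he, mul_assoc, ht.mul_self, mul_one] at h3
  omega

theorem strong_exchange' (cs : CoxeterSystem M W) (l : List B) {t : W} (ht : cs.IsReflection t)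
    (hlt : cs.length (cs.wordProd l * t) < cs.length (cs.wordProd l)) :
    ∃ j, j < l.length ∧ cs.wordProd l * t = cs.wordProd (l.eraseIdx j) := by
  have hm := strong_exchange cs l ht hlt
  obtain ⟨j, hj, rfl⟩ := List.getElem_of_mem hm
  refine ⟨j, by simpa using hj, ?_⟩
  rw [← cs.wordProd_mul_getD_rightInvSeq, List.getD_eq_getElem _ _ hj]

/-- Bruhat edge. -/
def bEdge (cs : CoxeterSystem M W) (x y : W) : Prop :=
  ∃ t, cs.IsReflection t ∧ y = x * t ∧ cs.length x < cs.length y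

/-- Bruhat order by chains. -/
def bLe (cs : CoxeterSystem M W) (x y : W) : Prop := Relation.ReflTransGen (bEdge cs) x y

theorem bEdge_simple (cs : CoxeterSystem M W) (x : W) (i : B)
    (h : cs.length x < cs.length (x * cs.simple i)) : bEdge cs x (x * cs.simple i) :=
  ⟨_, cs.isReflection_simple i, rfl, h⟩

theorem bEdge_mul (cs : CoxeterSystem M W) {x y : W} (h : bEdge cs x y) (i : B) :
    x * cs.simple i = y ∨ bEdge cs (x * cs.simple i) (y * cs.simple i) := by
  obtain ⟨t, ht, rfl, hl⟩ := h
  have hr : cs.IsReflection (cs.simple i * t * cs.simple i) := by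
    have := ht.conj (cs.simple i)
    rwa [cs.inv_simple] at this
  have he : x * t * cs.simple i = x * cs.simple i * (cs.simple i * t * cs.simple i) := by
    simp [mul_assoc]
  by_cases hc : cs.length (x * cs.simple i) < cs.length (x * t * cs.simple i)
  · exact Or.inr ⟨_, hr, he, hc⟩
  left
  have hne := hr.length_mul_left_ne (x * cs.simple i)
  rw [← he] at hne
  have h1 := cs.length_mul_simple x i
  have h2 := cs.length_mul_simple (x * t) i
  obtain ⟨l, hlr, hle⟩ := cs.exists_isReduced (x * t * cs.simple i)
  have hw : cs.wordProd (l ++ [i]) = x * t := by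
    rw [cs.wordProd_append, ← hle]; simp
  obtain ⟨j, hj, hj'⟩ := strong_exchange' cs (l ++ [i]) ht (by
    rw [hw, mul_assoc, ht.mul_self, mul_one]; exact hl)
  rw [hw, mul_assoc, ht.mul_self, mul_one] at hj'
  by_cases hjl : j < l.length
  · exfalso
    rw [List.eraseIdx_append_of_lt_length hjl, cs.wordProd_append] at hj'
    have h3 : x * cs.simple i = cs.wordProd (l.eraseIdx j) := by rw [hj']; simp
    have h4 := cs.length_wordProd_le (l.eraseIdx j)
    rw [← h3, List.length_eraseIdx_of_lt hjl] at h4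
    have h5 := hlr.eq
    rw [← hle] at h5
    omega
  · have : j = l.length := by simp at hj; omega
    subst this
    rw [List.eraseIdx_append_of_length_le le_rfl] at hj'
    simp at hj'
    have h6 : x = x * t * cs.simple i := hj'.trans hle.symm
    nth_rewrite 1 [h6]
    simp

theorem pi_ge (cs : CoxeterSystem M W) (i : B) (x : W) : bLe cs x (piOp cs i x) := by
  unfold piOp
  split_ifs with h
  · exact Relation.ReflTransGen.refl
  · rw [cs.not_isRightDescent_iff] at h
    exact Relation.ReflTransGen.single (bEdge_simple cs x i (by omega))

theorem pi_ge' (cs : CoxeterSystem M W) (i : B) (x : W) :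
    bLe cs (x * cs.simple i) (piOp cs i x) := by
  unfold piOp
  split_ifs with h
  · have := bEdge_simple cs (x * cs.simple i) i (by simpa [CoxeterSystem.IsRightDescent] using h)
    simp at this
    exact Relation.ReflTransGen.single this
  · exact Relation.ReflTransGen.refl

theorem pib_le (cs : CoxeterSystem M W) (i : B) (x : W) : bLe cs (pibOp cs i x) x := by
  unfold pibOp
  split_ifs with h
  · have := bEdge_simple cs (x * cs.simple i) i (by simpa [CoxeterSystem.IsRightDescent] using h)
    simp at this
    exact Relation.ReflTransGen.single this
  · exact Relation.ReflTransGen.refl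

theorem pib_le' (cs : CoxeterSystem M W) (i : B) (x : W) :
    bLe cs (pibOp cs i x) (x * cs.simple i) := by
  unfold pibOp
  split_ifs with h
  · exact Relation.ReflTransGen.refl
  · rw [cs.not_isRightDescent_iff] at h
    exact Relation.ReflTransGen.single (bEdge_simple cs x i (by omega))

theorem mul_le_pi (cs : CoxeterSystem M W) (i : B) {x y : W} (h : bLe cs x y) :
    bLe cs (x * cs.simple i) (piOp cs i y) := by
  induction h using Relation.ReflTransGen.head_induction_on with
  | refl => exact pi_ge' cs i y
  | head h1 h2 ih =>
    rcases bEdge_mul cs h1 i with h | h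
    · rw [h]; exact h2.trans (pi_ge cs i y)
    · exact Relation.ReflTransGen.head h ih

theorem pib_le_mul (cs : CoxeterSystem M W) (i : B) {x y : W} (h : bLe cs x y) :
    bLe cs (pibOp cs i x) (y * cs.simple i) := by
  induction h with
  | refl => exact pib_le' cs i x
  | tail h1 h2 ih =>
    rcases bEdge_mul cs h2 i with h | h
    · rw [← h]
      rw [cs.simple_mul_simple_cancel_right]
      exact (pib_le cs i x).trans h1
    · exact Relation.ReflTransGen.tail ih h

theorem pi_mono (cs : CoxeterSystem M W) (i : B) {x y : W} (h : bLe cs x y) :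
    bLe cs (piOp cs i x) (piOp cs i y) := by
  rw [show piOp cs i x = if cs.IsRightDescent x i then x else x * cs.simple i from rfl]
  split_ifs
  · exact h.trans (pi_ge cs i y)
  · exact mul_le_pi cs i h

theorem pib_mono (cs : CoxeterSystem M W) (i : B) {x y : W} (h : bLe cs x y) :
    bLe cs (pibOp cs i x) (pibOp cs i y) := by
  rw [show pibOp cs i y = if cs.IsRightDescent y i then y * cs.simple i else y from rfl]
  split_ifs
  · exact pib_le_mul cs i h
  · exact (pib_le cs i x).trans h

theorem pib_pi_le (cs : CoxeterSystem M W) (i : B) (x : W) :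
    bLe cs (pibOp cs i (piOp cs i x)) x := by
  by_cases h : cs.IsRightDescent x i
  · rw [show piOp cs i x = x from if_pos h]; exact pib_le cs i x
  · rw [show piOp cs i x = x * cs.simple i from if_neg h]
    simpa using pib_le' cs i (x * cs.simple i)

theorem bLe_of_leB (cs : CoxeterSystem M W) {x y : W} (h : leB cs x y) : bLe cs x y := by
  obtain ⟨l, hl, rfl, l', hs, rfl⟩ := h
  induction l using List.reverseRecOn generalizing l' with
  | nil => rw [List.sublist_nil.mp hs]; exact Relation.ReflTransGen.refl
  | append_singleton l i ih =>
    have hl0 : cs.IsReduced l := by simpa using hl.take l.length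
    have hasc : piOp cs i (cs.wordProd l) = cs.wordProd (l ++ [i]) := by
      rw [cs.wordProd_append, cs.wordProd_singleton]
      refine if_neg ?_
      rw [cs.not_isRightDescent_iff]
      have h1 := hl.eq
      have h2 := hl0.eq
      rw [cs.wordProd_append, cs.wordProd_singleton] at h1
      simp at h1
      omega
    rw [← hasc]
    obtain ⟨a, b, rfl, ha, hb⟩ := List.sublist_append_iff.mp hs
    have h1 := ih hl0 a ha
    rcases List.sublist_singleton.mp hb with rfl | rfl
    · rw [List.append_nil]
      exact h1.trans (pi_ge cs i _)
    · rw [cs.wordProd_append, cs.wordProd_singleton]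
      exact mul_le_pi cs i h1

theorem leB_of_bLe (cs : CoxeterSystem M W) {x y : W} (h : bLe cs x y) : leB cs x y := by
  obtain ⟨l, hl, rfl⟩ := cs.exists_isReduced y
  refine ⟨l, hl, rfl, ?_⟩
  induction h using Relation.ReflTransGen.head_induction_on with
  | refl => exact ⟨l, List.Sublist.refl _, rfl⟩
  | @head a b h1 h2 ih =>
    obtain ⟨l', hs, rfl⟩ := ih
    obtain ⟨t, ht, he, hlt⟩ := h1
    have ha : a = cs.wordProd l' * t := by rw [he, mul_assoc, ht.mul_self, mul_one]
    obtain ⟨j, hj, hj'⟩ := strong_exchange' cs l' ht (by rw [← ha]; exact hlt)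
    exact ⟨_, (List.eraseIdx_sublist l' j).trans hs, by rw [ha, hj']⟩

theorem actWord_mono (ops : B → W → W) (R : W → W → Prop)
    (h : ∀ i x y, R x y → R (ops i x) (ops i y)) (l : List B) (x y : W) (hxy : R x y) :
    R (actWord ops l x) (actWord ops l y) := by
  induction l generalizing x y with
  | nil => exact hxy
  | cons i l ih => exact ih _ _ (h i _ _ hxy)

theorem act_pi_eq (cs : CoxeterSystem M W) (l : List B) (x : W)
    (h : cs.length (x * cs.wordProd l) = cs.length x + l.length) :
    actWord (piOp cs) l x = x * cs.wordProd l := by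
  induction l generalizing x with
  | nil => simp [actWord]
  | cons i l ih =>
    rw [cs.wordProd_cons, ← mul_assoc] at h ⊢
    have h1 := cs.length_mul_le (x * cs.simple i) (cs.wordProd l)
    have h2 := cs.length_wordProd_le l
    have h3 := cs.length_mul_simple x i
    simp only [List.length_cons] at h
    have e : piOp cs i x = x * cs.simple i := by
      refine if_neg ?_
      rw [cs.not_isRightDescent_iff]; omega
    change actWord (piOp cs) l (piOp cs i x) = _
    rw [e]
    exact ih _ (by omega)

theorem act_pib_eq (cs : CoxeterSystem M W) (l : List B) (x : W)
    (h : cs.length (x * cs.wordProd l) + l.length = cs.length x) :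
    actWord (pibOp cs) l x = x * cs.wordProd l := by
  induction l generalizing x with
  | nil => simp [actWord]
  | cons i l ih =>
    rw [cs.wordProd_cons, ← mul_assoc] at h ⊢
    have h1 := cs.length_le_length_mul_add_right (x * cs.simple i) (cs.wordProd l)
    have h2 := cs.length_wordProd_le l
    have h3 := cs.length_mul_simple x i
    simp only [List.length_cons] at h
    have e : pibOp cs i x = x * cs.simple i := by
      refine if_pos ?_
      rw [cs.isRightDescent_iff]; omega
    change actWord (pibOp cs) l (pibOp cs i x) = _
    rw [e]
    exact ih _ (by omega)

theorem act_pib_pi_le (cs : CoxeterSystem M W) (l : List B) (x : W) :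
    bLe cs (actWord (pibOp cs) l.reverse (actWord (piOp cs) l x)) x := by
  induction l generalizing x with
  | nil => exact Relation.ReflTransGen.refl
  | cons i l ih =>
    have : actWord (pibOp cs) (i :: l).reverse (actWord (piOp cs) (i :: l) x)
      = pibOp cs i (actWord (pibOp cs) l.reverse (actWord (piOp cs) l (piOp cs i x))) := by
      simp [actWord]
    rw [this]
    exact (pib_mono cs i (ih _)).trans (pib_pi_le cs i x)

theorem act_pi_factor (cs : CoxeterSystem M W) (l : List B) (hl : cs.IsReduced l) (u : W) :
    ∃ z, actWord (piOp cs) l u = z * cs.wordProd l ∧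
      cs.length (z * cs.wordProd l) = cs.length z + l.length := by
  induction l using List.reverseRecOn with
  | nil => exact ⟨u, by simp [actWord], by simp⟩
  | append_singleton l i ih =>
    have hl0 : cs.IsReduced l := by simpa using hl.take l.length
    obtain ⟨z, hz, hz'⟩ := ih hl0
    have e : actWord (piOp cs) (l ++ [i]) u = piOp cs i (z * cs.wordProd l) := by
      rw [← hz]; simp [actWord]
    have hL : cs.wordProd (l ++ [i]) = cs.wordProd l * cs.simple i := by
      rw [cs.wordProd_append, cs.wordProd_singleton]
    have hlen := hl.eq
    rw [hL] at hlen
    rw [e, hL]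
    simp only [List.length_append, List.length_singleton] at hlen ⊢
    by_cases hd : cs.IsRightDescent (z * cs.wordProd l) i
    · obtain ⟨a, ha, rfl⟩ := cs.exists_isReduced z
      have hlt : cs.length (cs.wordProd (a ++ l) * cs.simple i) < cs.length (cs.wordProd (a ++ l)) := by
        rw [cs.wordProd_append]; exact hd
      obtain ⟨j, hj, hj'⟩ := strong_exchange' cs (a ++ l) (cs.isReflection_simple i) hlt
      rw [show piOp cs i (cs.wordProd a * cs.wordProd l) = cs.wordProd a * cs.wordProd l from if_pos hd]
      rw [cs.wordProd_append] at hj'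
      by_cases hja : j < a.length
      · rw [List.eraseIdx_append_of_lt_length hja, cs.wordProd_append] at hj'
        have hE : cs.wordProd a * cs.wordProd l
            = cs.wordProd (a.eraseIdx j) * (cs.wordProd l * cs.simple i) := by
          rw [← mul_assoc, ← hj']; simp
        refine ⟨cs.wordProd (a.eraseIdx j), hE, ?_⟩
        have h1 := cs.length_wordProd_le (a.eraseIdx j)
        rw [List.length_eraseIdx_of_lt hja] at h1
        have h2 := cs.length_mul_le (cs.wordProd (a.eraseIdx j)) (cs.wordProd l * cs.simple i)
        rw [← hE] at h2 ⊢
        have h3 := ha.eq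
        omega
      · exfalso
        push Not at hja
        have hjl : j - a.length < l.length := by simp at hj; omega
        rw [List.eraseIdx_append_of_length_le hja, cs.wordProd_append, mul_assoc] at hj'
        have h1 := mul_left_cancel hj'
        have h2 := cs.length_wordProd_le (l.eraseIdx (j - a.length))
        rw [← h1, List.length_eraseIdx_of_lt hjl] at h2
        omega
    · rw [show piOp cs i (z * cs.wordProd l) = z * cs.wordProd l * cs.simple i from if_neg hd]
      rw [cs.not_isRightDescent_iff] at hd
      exact ⟨z, by rw [mul_assoc], by rw [← mul_assoc]; omega⟩

theorem longest_add (cs : CoxeterSystem M W) (w0 : W) (hw0 : ∀ u : W, cs.length u ≤ cs.length w0)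
    (v : W) : cs.length w0 = cs.length (w0 * v⁻¹) + cs.length v := by
  obtain ⟨l, hl, rfl⟩ := cs.exists_isReduced v
  obtain ⟨z, hz, hz'⟩ := act_pi_factor cs l hl w0
  have hfix : ∀ l : List B, actWord (piOp cs) l w0 = w0 := by
    intro l
    induction l with
    | nil => rfl
    | cons i l ih =>
      have e : piOp cs i w0 = w0 := by
        refine if_pos ?_
        rw [cs.isRightDescent_iff]
        have := hw0 (w0 * cs.simple i)
        have := cs.length_mul_simple w0 i
        omega
      change actWord (piOp cs) l (piOp cs i w0) = _
      rw [e, ih]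
  rw [hfix] at hz
  rw [← hz] at hz'
  have : w0 * (cs.wordProd l)⁻¹ = z := by rw [hz]; group
  rw [this, hl.eq, hz']

theorem longest_sq (cs : CoxeterSystem M W) (w0 : W)
    (hw0 : ∀ u : W, cs.length u ≤ cs.length w0) : w0 * w0 = 1 := by
  have h := longest_add cs w0 hw0 w0⁻¹
  rw [cs.length_inv, inv_inv] at h
  exact cs.length_eq_zero_iff.mp (by omega)

end Helpers

/-- `e_w(u)` is the Bruhat-maximal element of `[1,u]_B ∩ [1,w]_L`. -/
theorem eIdem_apply_eq_max {B W : Type*} [Group W] [Finite W] {M : CoxeterMatrix B}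
    (cs : CoxeterSystem M W) (w w0 : W) (hw0 : ∀ u : W, cs.length u ≤ cs.length w0)
    (l1 l2 : List B) (h1 : cs.IsReduced l1) (h1' : cs.wordProd l1 = w⁻¹ * w0)
    (h2 : cs.IsReduced l2) (h2' : cs.wordProd l2 = w0 * w) (u : W) :
    (leB cs (eIdem cs l1 l2 u) u ∧ leL cs (eIdem cs l1 l2 u) w) ∧
    ∀ x, leB cs x u → leL cs x w → leB cs x (eIdem cs l1 l2 u) := by
  have hsq := longest_sq cs w0 hw0
  have hinv : w0⁻¹ = w0 := inv_eq_of_mul_eq_one_left hsq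
  set v := cs.wordProd l1 with hv
  have hv1 : cs.length v = l1.length := h1.eq
  have h2v : cs.wordProd l2 = v⁻¹ := by
    rw [h2', h1', mul_inv_rev, inv_inv, hinv]
  have hl2 : l2.length = l1.length := by
    rw [← h2.eq, h2v, cs.length_inv, hv1]
  have hw0v : w0 * v⁻¹ = w := by
    rw [h1', mul_inv_rev, inv_inv, hinv, ← mul_assoc, hsq, one_mul]
  have hwv : cs.length w0 = cs.length w + cs.length v := by
    have := longest_add cs w0 hw0 v
    rwa [hw0v] at this
  have key : ∀ z : W, cs.length (z * v) = cs.length z + l1.length →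
      ∀ l, cs.wordProd l = v⁻¹ → l.length = l1.length →
        actWord (pibOp cs) l (z * v) = z := by
    intro z hz l hl hl'
    rw [act_pib_eq, hl, mul_inv_cancel_right]
    rw [hl, mul_inv_cancel_right]; omega
  obtain ⟨z, hz, hz'⟩ := act_pi_factor cs l1 h1 u
  rw [← hv] at hz hz'
  have heu : eIdem cs l1 l2 u = z := by
    unfold eIdem
    rw [hz]
    exact key z hz' l2 h2v hl2
  refine ⟨⟨leB_of_bLe cs ?_, ?_⟩, ?_⟩
  · have h := act_pib_pi_le cs l1 u
    rw [hz, key z hz' l1.reverse (by rw [cs.wordProd_reverse]) (by simp)] at h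
    rwa [heu]
  · rw [heu]
    unfold leL
    have h := longest_add cs w0 hw0 (z * v)
    rw [mul_inv_rev, ← mul_assoc, hw0v] at h
    omega
  · intro x hxu hxw
    have hxv : cs.length (x * v) = cs.length x + l1.length := by
      unfold leL at hxw
      have h3 := cs.length_mul_le (w * x⁻¹) (x * v)
      have h4 := cs.length_mul_le x v
      have h5 : w * x⁻¹ * (x * v) = w0 := by rw [← hw0v]; group
      rw [h5] at h3
      omega
    have hex : eIdem cs l1 l2 x = x := by
      unfold eIdem
      rw [act_pi_eq cs l1 x hxv]
      exact key x hxv l2 h2v hl2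
    have hm : bLe cs (eIdem cs l1 l2 x) (eIdem cs l1 l2 u) :=
      actWord_mono _ (bLe cs) (fun i x y h => pib_mono cs i h) l2 _ _
        (actWord_mono _ (bLe cs) (fun i x y h => pi_mono cs i h) l1 _ _ (bLe_of_leB cs hxu))
    rw [hex] at hm
    exact leB_of_bLe cs hm
end

section
/- The set of left blocks of an element w of a finite Coxeter group is closed under union and intersection: if J_1 and J_2 are left blocks of w, then so are J_1 ∪ J_2 and J_1 ∩ J_2. -/
open scoped Classical

namespace LB

open Polynomial.Chebyshev in
lemma S_eval_cos (θ : ℝ) (n : ℤ) :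
    (Polynomial.Chebyshev.S ℝ n).eval (2 * Real.cos θ) * Real.sin θ = Real.sin ((n + 1) * θ) := by
  rw [← U_real_cos, ← S_comp_two_mul_X]
  simp

lemma refl_pow {V : Type*} [AddCommGroup V] [Module ℝ V] {x y : V} {f g : Module.Dual ℝ V}
    (hf : f x = 2) (hg : g y = 2) (m : ℕ) (hm : 2 ≤ m)
    (hfy : f y = -2 * Real.cos (Real.pi / m)) (hgx : g x = -2 * Real.cos (Real.pi / m)) :
    (Module.reflection hf * Module.reflection hg) ^ m = 1 := by
  rcases hm.eq_or_lt with rfl | hm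
  · have h1 : f y = 0 := by simp [hfy]
    have h2 : g x = 0 := by simp [hgx]
    ext z
    simp [pow_two, Module.reflection_apply, h1, h2, hf, hg]
    module
  · set θ := 2 * Real.pi / m with hθ
    have hm0 : (0:ℝ) < m := by positivity
    have hm2 : (2:ℝ) < m := by exact_mod_cast hm
    have hs : Real.sin θ ≠ 0 := by
      apply ne_of_gt
      apply Real.sin_pos_of_pos_of_lt_pi
      · have := Real.pi_pos; positivity
      · rw [hθ, div_lt_iff₀ hm0]; nlinarith [Real.pi_pos]
    have ht : 2 * Real.cos θ = f y * g x - 2 := by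
      have : θ = 2 * (Real.pi / m) := by rw [hθ]; ring
      rw [hfy, hgx, this, Real.cos_two_mul]; ring
    have hmθ : m * θ = 2 * Real.pi := by rw [hθ]; field_simp
    have key (a b : ℤ) (h : a + b + 2 = m) :
        (Polynomial.Chebyshev.S ℝ a).eval (2 * Real.cos θ) +
          (Polynomial.Chebyshev.S ℝ b).eval (2 * Real.cos θ) = 0 := by
      apply mul_right_cancel₀ hs
      rw [add_mul, S_eval_cos, S_eval_cos]
      have : ((a:ℝ) + 1) * θ = 2 * Real.pi - (b + 1) * θ := by
        have h' : (a:ℝ) + b + 2 = m := by exact_mod_cast h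
        rw [← hmθ, ← h']; ring
      rw [this, Real.sin_two_pi_sub]; simp
    ext z
    rw [Module.reflection_mul_reflection_pow_apply hf hg m z _ ht]
    rcases Nat.even_or_odd' m with ⟨k, hk | hk⟩
    · have e1 : ((m:ℤ) - 2) / 2 = k - 1 := by omega
      have e2 : ((m:ℤ) - 1) / 2 = k - 1 := by omega
      have := key (k-1) (k-1) (by omega)
      have h0 : (Polynomial.Chebyshev.S ℝ (k-1)).eval (2 * Real.cos θ) = 0 := by linarith
      rw [e1, e2, h0]; simp
    · have e1 : ((m:ℤ) - 2) / 2 = k - 1 := by omega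
      have e2 : ((m:ℤ) - 1) / 2 = k := by omega
      have e3 : ((m:ℤ) - 3) / 2 = k - 1 := by omega
      have e4 : (m:ℤ) / 2 = k := by omega
      rw [e1, e2, e3, e4, key k (k-1) (by omega)]; simp

variable {B W : Type*} [Group W] {M : CoxeterMatrix B}

noncomputable def cr (M : CoxeterMatrix B) (i : B) : Module.Dual ℝ (B →₀ ℝ) :=
  Finsupp.linearCombination ℝ (fun j => -2 * Real.cos (Real.pi / M i j))

lemma cr_single (i j : B) :
    cr M i (Finsupp.single j 1) = -2 * Real.cos (Real.pi / M i j) := by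
  simp [cr]

lemma cr_self (i : B) : cr M i (Finsupp.single i 1) = 2 := by
  simp [cr_single]

noncomputable def rf (M : CoxeterMatrix B) (i : B) : (B →₀ ℝ) ≃ₗ[ℝ] (B →₀ ℝ) :=
  Module.reflection (cr_self (M := M) i)

lemma rf_liftable : M.IsLiftable (rf M) := by
  intro i j
  rcases Nat.lt_or_ge (M i j) 2 with h | h
  · interval_cases h' : M i j
    · simp
    · by_cases hij : i = j
      · subst hij
        ext1 z
        simpa [rf] using Module.involutive_reflection (cr_self (M := M) i) z
      · exact absurd h' (M.off_diagonal i j hij)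
  · exact refl_pow _ _ _ h (cr_single i j) (by rw [cr_single, M.symmetric])

lemma mem_of_simple_mem (cs : CoxeterSystem M W) (J : Set B) (i : B)
    (h : cs.simple i ∈ parab cs J) : i ∈ J := by
  by_contra hi
  set φ := cs.lift ⟨rf M, rf_liftable⟩ with hφ
  have key : ∀ w ∈ parab cs J, ∀ v, (φ w v) i = v i := by
    intro w hw
    induction hw using Subgroup.closure_induction with
    | mem x hx =>
      obtain ⟨j, hj, rfl⟩ := hx
      intro v
      have hji : j ≠ i := fun e => hi (e ▸ hj)
      simp [hφ, cs.lift_apply_simple, rf, Module.reflection_apply, Finsupp.single_apply, hji]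
    | one => simp
    | mul x y _ _ hx hy => intro v; rw [map_mul, LinearEquiv.mul_apply, hx, hy]
    | inv x _ hx =>
      intro v
      rw [← hx (φ x⁻¹ v), ← LinearEquiv.mul_apply, ← map_mul]; simp
  have := key _ h (Finsupp.single i 1)
  rw [hφ, cs.lift_apply_simple] at this
  simp [rf] at this
  norm_num at this

/-- cocycle step -/
noncomputable def st (cs : CoxeterSystem M W) (i : B) : Function.End (W × ZMod 2) :=
  fun p => (cs.simple i * p.1 * cs.simple i, p.2 + if p.1 = cs.simple i then 1 else 0)

lemma st_pow (cs : CoxeterSystem M W) (i j : B) (n : ℕ) (p : W × ZMod 2) :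
    ((st cs i * st cs j) ^ n) p =
      ((cs.simple i * cs.simple j) ^ n * p.1 * ((cs.simple i * cs.simple j) ^ n)⁻¹,
        p.2 + ∑ k ∈ Finset.range (2 * n),
          if p.1 = ((cs.simple i * cs.simple j) ^ k)⁻¹ * cs.simple j then 1 else 0) := by
  induction n with
  | zero => simp; rfl
  | succ n ih =>
    have hx : cs.simple j * (cs.simple i * cs.simple j) ^ n * cs.simple j
        = ((cs.simple i * cs.simple j) ^ n)⁻¹ := by
      have := conj_pow (a := cs.simple j) (b := cs.simple i * cs.simple j) (i := n)
      rw [cs.inv_simple] at this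
      rw [← this, ← inv_pow]; simp [mul_assoc]
    rw [pow_succ', show 2 * (n + 1) = 2 * n + 1 + 1 by ring, Finset.sum_range_succ,
      Finset.sum_range_succ]
    change st cs i (st cs j (((st cs i * st cs j) ^ n) p)) = _
    rw [ih]
    generalize hX : (cs.simple i * cs.simple j) ^ n = X at *
    have hXj : X * cs.simple j = cs.simple j * X⁻¹ := by
      rw [← hx]; simp [mul_assoc]
    have h2 : (cs.simple i * cs.simple j) ^ (2 * n) = X * X := by
      rw [← hX, ← pow_add]; congr 1; ring
    have hXj' : X⁻¹ * cs.simple j = cs.simple j * X := by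
      rw [← hx]; simp [mul_assoc]
    have c1 : X * p.1 * X⁻¹ = cs.simple j ↔ p.1 = (X * X)⁻¹ * cs.simple j := by
      rw [mul_inv_eq_iff_eq_mul, ← hXj', ← eq_inv_mul_iff_mul_eq]
      simp [mul_assoc]
    have c2 : cs.simple j * (X * p.1 * X⁻¹) * cs.simple j = cs.simple i ↔
        p.1 = ((cs.simple i * cs.simple j) ^ (2 * n + 1))⁻¹ * cs.simple j := by
      have h3 : (cs.simple i * cs.simple j) ^ (2 * n + 1) = X * (cs.simple i * cs.simple j) * X := by
        rw [← hX, ← pow_succ, ← pow_add]; congr 1; ring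
      have h4 : (X * (cs.simple i * cs.simple j) * X)⁻¹ * cs.simple j =
          X⁻¹ * cs.simple j * cs.simple i * cs.simple j * X := by
        simp [mul_assoc, hXj']
      rw [h3, h4]
      constructor
      · intro h
        rw [← h]
        simp [mul_assoc]
      · intro h
        rw [h]
        simp [mul_assoc]
    simp only [st, c1, c2, h2, Prod.mk.injEq]
    refine ⟨by simp [pow_succ', hX, mul_assoc], by ring⟩

lemma st_liftable (cs : CoxeterSystem M W) : M.IsLiftable (st cs) := by
  intro i j
  funext p
  rw [st_pow, cs.simple_mul_simple_pow, two_mul, Finset.sum_range_add]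
  simp only [pow_add, cs.simple_mul_simple_pow, one_mul]
  rw [CharTwo.add_self_eq_zero]
  simp; rfl

lemma st_word (cs : CoxeterSystem M W) (ω : List B) (p : W × ZMod 2) :
    cs.lift ⟨st cs, st_liftable cs⟩ (cs.wordProd ω) p =
      (cs.wordProd ω * p.1 * (cs.wordProd ω)⁻¹, p.2 + ((cs.rightInvSeq ω).count p.1 : ℕ)) := by
  induction ω with
  | nil => simp; rfl
  | cons i ω ih =>
    rw [cs.wordProd_cons, map_mul]
    change cs.lift ⟨st cs, st_liftable cs⟩ (cs.simple i) (cs.lift ⟨st cs, st_liftable cs⟩ (cs.wordProd ω) p) = _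
    rw [ih, cs.lift_apply_simple]
    have c : cs.wordProd ω * p.1 * (cs.wordProd ω)⁻¹ = cs.simple i ↔
        (cs.wordProd ω)⁻¹ * cs.simple i * cs.wordProd ω = p.1 := by
      rw [mul_inv_eq_iff_eq_mul, mul_assoc, inv_mul_eq_iff_eq_mul, eq_comm]
    simp only [st, c, CoxeterSystem.rightInvSeq, List.count_cons, beq_iff_eq, Prod.mk.injEq]
    refine ⟨by simp [mul_assoc], by push_cast; ring⟩

lemma mem_ris (cs : CoxeterSystem M W) {ω ω' : List B} (hω : cs.IsReduced ω)
    (h : cs.wordProd ω = cs.wordProd ω') {t : W} (ht : t ∈ cs.rightInvSeq ω) :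
    t ∈ cs.rightInvSeq ω' := by
  have h1 := st_word cs ω (t, 0)
  rw [h, st_word] at h1
  have h2 := congrArg Prod.snd h1
  simp only [zero_add] at h2
  rw [List.count_eq_one_of_mem hω.nodup_rightInvSeq ht] at h2
  by_contra hc
  rw [List.count_eq_zero_of_not_mem hc] at h2
  simp at h2

lemma exists_word (cs : CoxeterSystem M W) (J : Set B) {w : W} (hw : w ∈ parab cs J) :
    ∃ ω : List B, (∀ i ∈ ω, i ∈ J) ∧ cs.wordProd ω = w := by
  induction hw using Subgroup.closure_induction with
  | mem x hx => obtain ⟨j, hj, rfl⟩ := hx; exact ⟨[j], by simpa using hj, by simp⟩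
  | one => exact ⟨[], by simp, by simp⟩
  | mul x y _ _ hx hy =>
    obtain ⟨a, ha, rfl⟩ := hx
    obtain ⟨b, hb, rfl⟩ := hy
    exact ⟨a ++ b, by grind, by simp [cs.wordProd_append]⟩
  | inv x _ hx =>
    obtain ⟨a, ha, rfl⟩ := hx
    exact ⟨a.reverse, by simpa using ha, by simp⟩

lemma simple_mem (cs : CoxeterSystem M W) {J : Set B} {i : B} (hi : i ∈ J) :
    cs.simple i ∈ parab cs J := Subgroup.subset_closure ⟨i, hi, rfl⟩

lemma word_mem (cs : CoxeterSystem M W) {J : Set B} {ω : List B} (h : ∀ i ∈ ω, i ∈ J) :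
    cs.wordProd ω ∈ parab cs J := by
  induction ω with
  | nil => simp [one_mem]
  | cons i ω ih =>
    rw [cs.wordProd_cons]
    exact mul_mem (simple_mem cs (h i (by simp))) (ih fun k hk => h k (by simp [hk]))

lemma ris_mem (cs : CoxeterSystem M W) {J : Set B} {ω : List B} (h : ∀ i ∈ ω, i ∈ J)
    {t : W} (ht : t ∈ cs.rightInvSeq ω) : t ∈ parab cs J := by
  induction ω with
  | nil => simp at ht
  | cons i ω ih =>
    have h' : ∀ k ∈ ω, k ∈ J := fun k hk => h k (by simp [hk])
    have hw := word_mem cs h'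
    rw [CoxeterSystem.rightInvSeq, List.mem_cons] at ht
    rcases ht with rfl | ht
    · exact mul_mem (mul_mem (inv_mem hw) (simple_mem cs (h i (by simp)))) hw
    · exact ih h' ht

lemma last_mem (cs : CoxeterSystem M W) {J : Set B} {ω : List B} {i : B}
    (hr : cs.IsReduced (ω ++ [i])) (h : cs.wordProd (ω ++ [i]) ∈ parab cs J) : i ∈ J := by
  obtain ⟨ω', h', e⟩ := exists_word cs J h
  apply mem_of_simple_mem cs
  refine ris_mem cs h' (mem_ris cs hr e.symm ?_)
  rw [← List.concat_eq_append, cs.rightInvSeq_concat]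
  simp

lemma red_mem (cs : CoxeterSystem M W) {J : Set B} (ω : List B)
    (hr : cs.IsReduced ω) (h : cs.wordProd ω ∈ parab cs J) : ∀ i ∈ ω, i ∈ J := by
  induction ω using List.reverseRecOn with
  | nil => simp
  | append_singleton ω i ih =>
    have hi := last_mem cs hr h
    have hr' : cs.IsReduced ω := by simpa using hr.take ω.length
    have hw : cs.wordProd ω ∈ parab cs J := by
      rw [cs.wordProd_append, cs.wordProd_singleton] at h
      exact (Subgroup.mul_mem_cancel_right _ (simple_mem cs hi)).1 h
    intro k hk
    rw [List.mem_append, List.mem_singleton] at hk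
    rcases hk with hk | rfl
    · exact ih hr' hw k hk
    · exact hi

lemma parab_inter (cs : CoxeterSystem M W) (J K : Set B) :
    parab cs (J ∩ K) = parab cs J ⊓ parab cs K := by
  apply le_antisymm
  · exact le_inf (Subgroup.closure_mono (Set.image_mono Set.inter_subset_left))
      (Subgroup.closure_mono (Set.image_mono Set.inter_subset_right))
  · rintro w ⟨h1, h2⟩
    obtain ⟨ω, hr, rfl⟩ := cs.exists_isReduced w
    exact word_mem cs fun i hi => ⟨red_mem cs ω hr h1 i hi, red_mem cs ω hr h2 i hi⟩

lemma parab_union (cs : CoxeterSystem M W) (J K : Set B) :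
    parab cs (J ∪ K) = parab cs J ⊔ parab cs K := by
  simp [parab, Set.image_union, Subgroup.closure_union]

lemma block_iff (cs : CoxeterSystem M W) (w : W) (J K : Set B) :
    ((fun x => w * x) '' (parab cs K : Set W) = (fun x => x * w) '' (parab cs J : Set W)) ↔
    (parab cs K).map (MulAut.conj w).toMonoidHom = parab cs J := by
  rw [← SetLike.coe_set_eq (p := Subgroup.map _ _),
    ← (Set.image_injective.2 (mul_left_injective w)).eq_iff (b := (parab cs J : Set W)),
    Subgroup.coe_map, Set.image_image]
  simp

end LB

/-- The set of left blocks of `w` is closed under union and intersection. -/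
theorem leftBlocks_union_inter {B W : Type*} [Group W] [Finite W] {M : CoxeterMatrix B}
    (cs : CoxeterSystem M W) (w : W) (J₁ J₂ : Set B)
    (h₁ : isLeftBlock cs w J₁) (h₂ : isLeftBlock cs w J₂) :
    isLeftBlock cs w (J₁ ∪ J₂) ∧ isLeftBlock cs w (J₁ ∩ J₂) := by
  obtain ⟨K₁, h₁⟩ := h₁
  obtain ⟨K₂, h₂⟩ := h₂
  rw [LB.block_iff] at h₁ h₂
  refine ⟨⟨K₁ ∪ K₂, ?_⟩, ⟨K₁ ∩ K₂, ?_⟩⟩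
  · rw [LB.block_iff, LB.parab_union, LB.parab_union, Subgroup.map_sup, h₁, h₂]
  · rw [LB.block_iff, LB.parab_inter, LB.parab_inter,
      Subgroup.map_inf _ _ _ (MulAut.conj w).injective, h₁, h₂]
end
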